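/- Let W be an algebraic Weyl tensor on Minkowski ℝ⁴. Then the Riemannian Weyl operator Ŵ_g commutes with the Riemannian Hodge star S (i.e., Ŵ_g ∘ S = S ∘ Ŵ_g) if and only if W(e₁,x,y,e₁) = 0 for all x,y ∈ ℝ⁴. -/

import Mathlib

open scoped BigOperators

/-- Vectors in ℝ⁴. -/
abbrev V4 : Type := Fin 4 → ℝ

/-- ℝ⁶, identified with Λ²ℝ⁴ via the ordered basis
`e₁∧e₂, e₁∧e₃, e₁∧e₄, e₃∧e₄, e₄∧e₂, e₂∧e₃`. -/
abbrev V6 : Type := Fin 6 → ℝ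

/-- Covariant 4-tensors (multilinear maps ℝ⁴×ℝ⁴×ℝ⁴×ℝ⁴ → ℝ). -/
abbrev Tensor4 : Type := MultilinearMap ℝ (fun _ : Fin 4 => V4) ℝ

/-- Evaluation of a 4-tensor on four vectors. -/
def tapp (W : Tensor4) (x y z w : V4) : ℝ := W ![x, y, z, w]

/-- Standard basis of ℝ⁴ (0-indexed: `e 0 = e₁`, …, `e 3 = e₄`). -/
def e (i : Fin 4) : V4 := Pi.single i 1

/-- Standard basis of ℝ⁶ (0-indexed: `u 0 = u₁`, …, `u 5 = u₆`). -/
def u (c : Fin 6) : V6 := Pi.single c 1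

/-- The index pairs of the six coordinate 2-planes
`e₁∧e₂, e₁∧e₃, e₁∧e₄, e₃∧e₄, e₄∧e₂, e₂∧e₃` (0-indexed). -/
def pairs : Fin 6 → Fin 4 × Fin 4 := ![(0,1), (0,2), (0,3), (2,3), (3,1), (1,2)]

/-- The Minkowski inner product `η` on ℝ⁴ (timelike direction `e₁`). -/
def etaR4 (x y : V4) : ℝ := -(x 0 * y 0) + x 1 * y 1 + x 2 * y 2 + x 3 * y 3

/-- The Lorentzian inner product `⟨·,·⟩_L` on ℝ⁶, of signature (−−−+++). -/
def ipL (ξ η : V6) : ℝ :=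
  -(ξ 0 * η 0) - ξ 1 * η 1 - ξ 2 * η 2 + ξ 3 * η 3 + ξ 4 * η 4 + ξ 5 * η 5

/-- The matrix of the Lorentzian Hodge star `J = [[0, I₃],[−I₃, 0]]`. -/
def Jmat : Matrix (Fin 6) (Fin 6) ℝ :=
  !![0,0,0,1,0,0;
     0,0,0,0,1,0;
     0,0,0,0,0,1;
     -1,0,0,0,0,0;
     0,-1,0,0,0,0;
     0,0,-1,0,0,0]

/-- The Lorentzian Hodge star `J` as a linear map on ℝ⁶. -/
def J : V6 →ₗ[ℝ] V6 := Matrix.toLin' Jmat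

/-- The matrix of the Riemannian Hodge star `S = [[0, I₃],[I₃, 0]]`. -/
def Smat : Matrix (Fin 6) (Fin 6) ℝ :=
  !![0,0,0,1,0,0;
     0,0,0,0,1,0;
     0,0,0,0,0,1;
     1,0,0,0,0,0;
     0,1,0,0,0,0;
     0,0,1,0,0,0]

/-- The Riemannian Hodge star `S` as a linear map on ℝ⁶. -/
def S : V6 →ₗ[ℝ] V6 := Matrix.toLin' Smat

/-- `W` is an algebraic Weyl tensor on Euclidean ℝ⁴. -/
def IsWeylE (W : Tensor4) : Prop :=
  (∀ x y z w, tapp W x y z w = - tapp W y x z w) ∧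
  (∀ x y z w, tapp W x y z w = - tapp W x y w z) ∧
  (∀ x y z w, tapp W x y z w = tapp W z w x y) ∧
  (∀ x y z w, tapp W x y z w + tapp W y z x w + tapp W z x y w = 0) ∧
  (∀ x y, ∑ i : Fin 4, tapp W (e i) x y (e i) = 0)

/-- `W` is an algebraic Weyl tensor on Minkowski ℝ⁴ (η-trace-free). -/
def IsWeylM (W : Tensor4) : Prop :=
  (∀ x y z w, tapp W x y z w = - tapp W y x z w) ∧
  (∀ x y z w, tapp W x y z w = - tapp W x y w z) ∧
  (∀ x y z w, tapp W x y z w = tapp W z w x y) ∧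
  (∀ x y z w, tapp W x y z w + tapp W y z x w + tapp W z x y w = 0) ∧
  (∀ x y, -(tapp W (e 0) x y (e 0)) + tapp W (e 1) x y (e 1)
      + tapp W (e 2) x y (e 2) + tapp W (e 3) x y (e 3) = 0)

/-- `WL` is the Lorentzian Weyl operator of `W`:
`⟨WL u_c, u_r⟩_L = W(e_{i(c)}, e_{j(c)}, e_{i(r)}, e_{j(r)})`. -/
def IsLorentzWeylOp (W : Tensor4) (WL : V6 →ₗ[ℝ] V6) : Prop :=
  ∀ c r : Fin 6,
    ipL (WL (u c)) (u r) =
      tapp W (e (pairs c).1) (e (pairs c).2) (e (pairs r).1) (e (pairs r).2)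

/-- `Wg` is the Riemannian Weyl operator of `W`:
`⟨Wg u_c, u_r⟩ = W(e_{i(c)}, e_{j(c)}, e_{i(r)}, e_{j(r)})` w.r.t. the dot product. -/
def IsRiemWeylOp (W : Tensor4) (Wg : V6 →ₗ[ℝ] V6) : Prop :=
  ∀ c r : Fin 6,
    (∑ i : Fin 6, Wg (u c) i * u r i) =
      tapp W (e (pairs c).1) (e (pairs c).2) (e (pairs r).1) (e (pairs r).2)

theorem riemWeylOp_apply {W : Tensor4} {Wg : V6 →ₗ[ℝ] V6} (hWg : IsRiemWeylOp W Wg)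
    (c r : Fin 6) :
    Wg (u c) r = tapp W (e (pairs c).1) (e (pairs c).2) (e (pairs r).1) (e (pairs r).2) := by
  rw [← hWg c r]
  simp [u, Pi.single_apply]

theorem S_apply (v : V6) (r : Fin 6) : S v r = v (r + 3) := by
  fin_cases r <;>
    simp [S, Smat, Matrix.mulVec, dotProduct, Fin.sum_univ_six]

theorem S_u (c : Fin 6) : S (u c) = u (c + 3) := by
  ext r
  rw [S_apply]
  have h : r + 3 = c ↔ r = c + 3 := by revert c r; decide
  simp [u, Pi.single_apply, h]

/-- An operator commutes with `S` iff its matrix is invariant under the swap of the two halves of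
the index set. -/
theorem comp_S_eq_S_comp_iff (A : V6 →ₗ[ℝ] V6) :
    A.comp S = S.comp A ↔ ∀ c r : Fin 6, A (u (c + 3)) r = A (u c) (r + 3) := by
  constructor
  · intro h c r
    rw [← S_u, ← S_apply (A (u c)) r]
    exact congrFun (LinearMap.congr_fun h (u c)) r
  · intro h
    refine (Pi.basisFun ℝ (Fin 6)).ext fun c => ?_
    ext r
    have hc : Pi.basisFun ℝ (Fin 6) c = u c := by simp [u]
    rw [hc, LinearMap.comp_apply, LinearMap.comp_apply, S_u, S_apply, h]

/-- The components of a Minkowski Weyl tensor on coordinate planes: the electric block changes sign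
and the magnetic block is preserved when both planes are replaced by their complements. -/
theorem IsWeylM.tapp_complement {W : Tensor4} (hW : IsWeylM W) (i j : Fin 3) :
    let M : Fin 6 → Fin 6 → ℝ := fun c r =>
      tapp W (e (pairs c).1) (e (pairs c).2) (e (pairs r).1) (e (pairs r).2)
    M (i.natAdd 3) (j.natAdd 3) = -M (i.castAdd 3) (j.castAdd 3) ∧
      M (i.natAdd 3) (j.castAdd 3) = M (i.castAdd 3) (j.natAdd 3) := by
  obtain ⟨h₁, h₂, h₃, -, h₅⟩ := hW
  generalize hw : (fun i j k l => tapp W (e i) (e j) (e k) (e l)) = w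
  have ew : ∀ i j k l, tapp W (e i) (e j) (e k) (e l) = w i j k l := fun i j k l => by rw [← hw]
  have a₁ : ∀ i j k l, w i j k l = -w j i k l := fun i j k l => by simp only [← ew]; apply h₁
  have a₂ : ∀ i j k l, w i j k l = -w i j l k := fun i j k l => by simp only [← ew]; apply h₂
  have a₃ : ∀ i j k l, w i j k l = w k l i j := fun i j k l => by simp only [← ew]; apply h₃
  have a₅ : ∀ i j, -w 0 i j 0 + w 1 i j 1 + w 2 i j 2 + w 3 i j 3 = 0 := fun i j => by
    simp only [← ew]; apply h₅
  have z₁ : ∀ i k l, w i i k l = 0 := fun i k l => by linarith [a₁ i i k l]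
  have z₂ : ∀ i k l, w k l i i = 0 := fun i k l => by linarith [a₂ k l i i]
  simp only [ew]
  have t₀₀ := a₅ 0 0
  have t₀₁ := a₅ 0 1
  have t₀₂ := a₅ 0 2
  have t₀₃ := a₅ 0 3
  have t₁₁ := a₅ 1 1
  have t₁₂ := a₅ 1 2
  have t₁₃ := a₅ 1 3
  have t₂₂ := a₅ 2 2
  have t₂₃ := a₅ 2 3
  have t₃₃ := a₅ 3 3
  fin_cases i <;> fin_cases j <;> simp [pairs, Fin.natAdd, Fin.castAdd, Fin.castLE] <;> grind

theorem tapp_eq_zero_of_basis (W : Tensor4) (a d : V4)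
    (h : ∀ i j, tapp W a (e i) (e j) d = 0) (x y : V4) : tapp W a x y d = 0 := by
  have h₁ : ∀ x y, tapp W a x y d = W (Function.update ![a, 0, y, d] 1 x) := fun x y => by
    refine congrArg W (funext fun i => ?_)
    fin_cases i <;> rfl
  have h₂ : ∀ x y, tapp W a x y d = W (Function.update ![a, x, 0, d] 2 y) := fun x y => by
    refine congrArg W (funext fun i => ?_)
    fin_cases i <;> rfl
  let B : V4 →ₗ[ℝ] V4 →ₗ[ℝ] ℝ := LinearMap.mk₂ ℝ (fun x y => tapp W a x y d)
    (fun x x' y => by simp only [h₁, W.map_update_add])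
    (fun c x y => by simp only [h₁, W.map_update_smul])
    (fun x y y' => by simp only [h₂, W.map_update_add])
    (fun c x y => by simp only [h₂, W.map_update_smul])
  have hB : B = 0 := by
    refine LinearMap.ext_basis (Pi.basisFun ℝ (Fin 4)) (Pi.basisFun ℝ (Fin 4)) fun i j => ?_
    simpa [B, e] using h i j
  exact LinearMap.congr_fun₂ hB x y

/-- Proposition `prop:WT1`: for an algebraic Weyl tensor `W` on
Minkowski ℝ⁴, the Riemannian Weyl operator `Ŵ_g` commutes with the Riemannian
Hodge star `S` iff `W(e₁,·,·,e₁) = 0`. -/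
theorem stmt7 (W : Tensor4) (Wg : V6 →ₗ[ℝ] V6)
    (hW : IsWeylM W) (hWg : IsRiemWeylOp W Wg) :
    Wg.comp S = S.comp Wg ↔ ∀ x y : V4, tapp W (e 0) x y (e 0) = 0 := by
  have hM := fun i j => hW.tapp_complement i j
  simp only [← riemWeylOp_apply hWg] at hM
  have electric : ∀ i j : Fin 3, Wg (u (i.castAdd 3)) (j.castAdd 3) =
      -tapp W (e 0) (e i.succ) (e j.succ) (e 0) := fun i j => by
    have hp : ∀ i : Fin 3, pairs (i.castAdd 3) = (0, i.succ) := by decide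
    rw [riemWeylOp_apply hWg, hp, hp, hW.2.1]
  have hl : ∀ i : Fin 3, (i.castAdd 3 : Fin 6) + 3 = i.natAdd 3 := by decide
  have hr : ∀ i : Fin 3, (i.natAdd 3 : Fin 6) + 3 = i.castAdd 3 := by decide
  rw [comp_S_eq_S_comp_iff]
  constructor
  · intro h
    refine tapp_eq_zero_of_basis W _ _ fun i j => ?_
    cases i using Fin.cases with
    | zero => linarith [hW.1 (e 0) (e 0) (e j) (e 0)]
    | succ i =>
      cases j using Fin.cases with
      | zero => linarith [hW.2.1 (e 0) (e i.succ) (e 0) (e 0)]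
      | succ j =>
        have hc := h (i.castAdd 3) (j.natAdd 3)
        rw [hl, hr] at hc
        linarith [electric i j, (hM i j).1]
  · intro h
    have hA : ∀ i j : Fin 3, Wg (u (i.castAdd 3)) (j.castAdd 3) = 0 := fun i j => by
      rw [electric, h, neg_zero]
    have hD : ∀ i j : Fin 3, Wg (u (i.natAdd 3)) (j.natAdd 3) = 0 := fun i j => by
      rw [(hM i j).1, hA, neg_zero]
    intro c r
    refine Fin.addCases (m := 3) (n := 3) (fun i => ?_) (fun i => ?_) c <;>
      refine Fin.addCases (m := 3) (n := 3) (fun j => ?_) (fun j => ?_) r <;>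
      simp only [hl, hr, hA, hD, (hM _ _).2]
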